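/- Let G be a finite group, Q a 2-subgroup of G, and K a normal subgroup of G of odd order. Then QK is a perfect code of G if and only if Q is a perfect code of G. -/

import Mathlib

open Pointwise

/-- A subgroup `H` of `G` is a perfect code of `G` if there is a left transversal `T`
of `H` in `G` with `T = T⁻¹` and `1 ∈ T` (a Cayley transversal). -/
def IsPerfectCode {G : Type*} [Group G] (H : Subgroup G) : Prop :=
  ∃ T : Set G, (1 : G) ∈ T ∧ T⁻¹ = T ∧ ∀ g : G, ∃! t, t ∈ T ∧ g⁻¹ * t ∈ H

/-- Normalised-square-root condition. -/
def NCond {G : Type*} [Group G] (H : Subgroup G) : Prop :=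
  ∀ x : G, (∀ h ∈ H, x⁻¹ * h * x ∈ H) → x * x ∈ H → ∃ h ∈ H, (x * h) * (x * h) = 1

/-- Double coset of `x`. -/
def DC {G : Type*} [Group G] (H : Subgroup G) (x : G) : Set G :=
  {y | ∃ a ∈ H, ∃ b ∈ H, y = a * x * b}

/-- Left cosets in the double coset of `x`. -/
def OC {G : Type*} [Group G] (H : Subgroup G) (x : G) : Set (G ⧸ H) :=
  (fun g : G => (g : G ⧸ H)) '' DC H x

theorem ncond_of_pc {G : Type*} [Group G] (H : Subgroup G) (hp : IsPerfectCode H) : NCond H := by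
  obtain ⟨T, h1, hT, hu⟩ := hp
  intro x hx hxx
  obtain ⟨t, ⟨htT, htH⟩, huniq⟩ := hu x
  have hti : t⁻¹ ∈ T := by rw [← hT]; simpa using htT
  have h2 : x⁻¹ * t⁻¹ ∈ H := by
    have := H.mul_mem (hx _ (H.inv_mem htH)) (H.inv_mem hxx)
    convert this using 1; group
  have := huniq t⁻¹ ⟨hti, h2⟩
  refine ⟨x⁻¹ * t, htH, ?_⟩
  rw [mul_inv_cancel_left]
  nth_rewrite 1 [← this]
  simp

section
variable {G : Type*} [Group G] {H : Subgroup G}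

theorem mem_DC_self (x : G) : x ∈ DC H x := ⟨1, H.one_mem, 1, H.one_mem, by simp⟩

theorem DC_symm {x y : G} (h : y ∈ DC H x) : x ∈ DC H y := by
  obtain ⟨a, ha, b, hb, rfl⟩ := h
  exact ⟨a⁻¹, H.inv_mem ha, b⁻¹, H.inv_mem hb, by group⟩

theorem DC_trans {x y z : G} (h : y ∈ DC H x) (h' : z ∈ DC H y) : z ∈ DC H x := by
  obtain ⟨a, ha, b, hb, rfl⟩ := h
  obtain ⟨c, hc, d, hd, rfl⟩ := h'
  exact ⟨c * a, H.mul_mem hc ha, b * d, H.mul_mem hb hd, by group⟩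

theorem DC_inv {x y : G} (h : y ∈ DC H x) : y⁻¹ ∈ DC H x⁻¹ := by
  obtain ⟨a, ha, b, hb, rfl⟩ := h
  exact ⟨b⁻¹, H.inv_mem hb, a⁻¹, H.inv_mem ha, by group⟩

theorem DC_coset {x y z : G} (h : y ∈ DC H x) (h' : (y : G ⧸ H) = z) : z ∈ DC H x := by
  rw [QuotientGroup.eq] at h'
  exact DC_trans h ⟨1, H.one_mem, _, h', by group⟩

theorem DC_eq {x y : G} (h : y ∈ DC H x) : DC H y = DC H x := by
  ext z
  exact ⟨fun hz => DC_trans h hz, fun hz => DC_trans (DC_symm h) hz⟩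

theorem mem_OC {x y : G} : (y : G ⧸ H) ∈ OC H x ↔ y ∈ DC H x := by
  constructor
  · rintro ⟨z, hz, hzy⟩
    exact DC_coset hz hzy
  · intro h; exact ⟨y, h, rfl⟩

theorem card_DC [Finite G] (x : G) : (DC H x).ncard = Nat.card H * (OC H x).ncard := by
  have h : DC H x = (QuotientGroup.mk : G → G ⧸ H) ⁻¹' (OC H x) := by
    ext y; exact mem_OC.symm
  rw [h]
  have := Nat.card_congr (QuotientGroup.preimageMkEquivSubgroupProdSet H (OC H x))
  rw [Nat.card_prod] at this
  exact this

theorem DC_inv_eq (x : G) : DC H x⁻¹ = (DC H x)⁻¹ := by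
  ext y
  rw [Set.mem_inv]
  constructor
  · intro h; simpa using DC_inv h
  · intro h; simpa using DC_inv h

theorem card_OC_inv [Finite G] (x : G) : (OC H x⁻¹).ncard = (OC H x).ncard := by
  have h1 := card_DC (H := H) x
  have h2 := card_DC (H := H) x⁻¹
  rw [DC_inv_eq, ← Set.image_inv_eq_inv, Set.ncard_image_of_injective _ inv_injective, h1] at h2
  exact (Nat.eq_of_mul_eq_mul_left Nat.card_pos h2).symm

theorem meet {x y z : G} (hy : y ∈ DC H x) (hz : z⁻¹ ∈ DC H x) :
    ∃ t : G, (t : G ⧸ H) = y ∧ ((t⁻¹ : G) : G ⧸ H) = z := by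
  obtain ⟨a, ha, b, hb, rfl⟩ := hy
  obtain ⟨c, hc, d, hd, hz⟩ := hz
  obtain rfl : z = (c * x * d)⁻¹ := by rw [← hz, inv_inv]
  refine ⟨a * x * d, ?_, ?_⟩
  · rw [QuotientGroup.eq]
    convert H.mul_mem (H.inv_mem hd) hb using 1; group
  · rw [QuotientGroup.eq]
    convert H.mul_mem ha (H.inv_mem hc) using 1; group

theorem even_of_inv [Finite G] (S : Set G) (hS : S⁻¹ = S) (h : ∀ t ∈ S, t * t ≠ 1) :
    Even S.ncard := by
  classical
  have hf : S.Finite := Set.toFinite S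
  rw [Set.ncard_eq_toFinset_card S hf]
  have : ∑ _t ∈ hf.toFinset, (1 : ZMod 2) = 0 := by
    refine Finset.sum_involution (fun t _ => t⁻¹) ?_ ?_ ?_ ?_
    · intro a _; decide
    · intro a ha _ hh
      refine h a (by simpa using ha) ?_
      nth_rewrite 1 [← hh]; simp
    · intro a ha
      rw [Set.Finite.mem_toFinset] at ha ⊢
      rw [← hS]; simpa using ha
    · intro a _; simp
  rw [Finset.sum_const, nsmul_one] at this
  exact (ZMod.natCast_eq_zero_iff_even).1 this

/-- Partial inverse-closed transversals. -/
structure Good (H : Subgroup G) (T : Set G) : Prop where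
  one : (1 : G) ∈ T
  inv : T⁻¹ = T
  inj : Set.InjOn (fun g : G => (g : G ⧸ H)) T
  sq : ∀ t ∈ T, t * t = 1 → (OC H t).ncard = 1

theorem good_one : Good H ({1} : Set G) where
  one := rfl
  inv := by simp
  inj := by simp
  sq := by
    rintro t rfl _
    rw [Set.ncard_eq_one]
    refine ⟨((1 : G) : G ⧸ H), ?_⟩
    ext c
    induction c using QuotientGroup.induction_on with
    | H z =>
      rw [mem_OC, Set.mem_singleton_iff]
      constructor
      · rintro ⟨a, ha, b, hb, rfl⟩
        rw [QuotientGroup.eq]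
        simpa using H.mul_mem (H.inv_mem hb) (H.inv_mem ha)
      · intro h; exact DC_coset (mem_DC_self 1) h.symm

theorem Good.extend [Finite G] {T : Set G} (hT : Good H T) {t : G}
        (h1 : ∀ s ∈ T, (s : G ⧸ H) ≠ t) (h2 : ∀ s ∈ T, (s : G ⧸ H) ≠ (t⁻¹ : G))
    (h3 : (t : G ⧸ H) = (t⁻¹ : G) → t = t⁻¹) (h4 : t * t = 1 → (OC H t).ncard = 1) :
    Good H (T ∪ {t, t⁻¹}) where
  one := Or.inl hT.one
  inv := by
    rw [Set.union_inv, hT.inv]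
    simp [Set.pair_comm]
  inj := by
    rintro a (ha | rfl | rfl) b (hb | rfl | rfl) hab
    · exact hT.inj ha hb hab
    · exact absurd hab (h1 _ ha)
    · exact absurd hab (h2 _ ha)
    · exact absurd hab.symm (h1 _ hb)
    · rfl
    · exact h3 hab
    · exact absurd hab.symm (h2 _ hb)
    · exact (h3 hab.symm).symm
    · rfl
  sq := by
    rintro a (ha | rfl | rfl) haa
    · exact hT.sq _ ha haa
    · exact h4 haa
    · rw [card_OC_inv]
      exact h4 (by simpa using congrArg (·⁻¹) haa)

end

theorem good_count {G : Type*} [Group G] [Finite G] {H : Subgroup G} {T : Set G} (hT : Good H T)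
    (h2 : ∀ x : G, Even (OC H x).ncard ∨ (OC H x).ncard = 1) {x : G}
    (hx : ∀ s ∈ T, (s : G ⧸ H) ≠ x) (hn : ¬ (x⁻¹ ∈ DC H x ∧ (OC H x).ncard = 1)) :
    ∃ z : G, z⁻¹ ∈ DC H x ∧ (∀ s ∈ T, (s : G ⧸ H) ≠ z) ∧ (z : G ⧸ H) ≠ x := by
  have himg : ∀ y : G, ((fun g : G => (g : G ⧸ H)) '' (T ∩ DC H y)).ncard = (T ∩ DC H y).ncard :=
    fun y => (hT.inj.mono Set.inter_subset_left).ncard_image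
  have hsub : ∀ y : G, (fun g : G => (g : G ⧸ H)) '' (T ∩ DC H y) ⊆ OC H y :=
    fun y => Set.image_mono Set.inter_subset_right
  have hxO : (x : G ⧸ H) ∈ OC H x := mem_OC.2 (mem_DC_self x)
  have hxI : (x : G ⧸ H) ∉ (fun g : G => (g : G ⧸ H)) '' (T ∩ DC H x) := by
    rintro ⟨s, hs, hsx⟩
    exact hx s hs.1 hsx
  have hinv : T ∩ DC H x⁻¹ = (T ∩ DC H x)⁻¹ := by
    rw [Set.inter_inv, hT.inv, DC_inv_eq]
  by_cases hxx : x⁻¹ ∈ DC H x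
  · have hne : (OC H x).ncard ≠ 1 := fun h => hn ⟨hxx, h⟩
    have hev : Even (OC H x).ncard := (h2 x).resolve_right hne
    have hDD : DC H x⁻¹ = DC H x := DC_eq hxx
    rw [hDD] at hinv
    have hev2 : Even (T ∩ DC H x).ncard := by
      refine even_of_inv _ hinv.symm ?_
      intro t ht htt
      apply hne
      rw [← hT.sq t ht.1 htt, OC, OC, DC_eq ht.2]
    by_contra hcon
    push Not at hcon
    have : OC H x = insert (x : G ⧸ H) ((fun g : G => (g : G ⧸ H)) '' (T ∩ DC H x)) := by
      apply Set.Subset.antisymm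
      · rintro _ ⟨z, hz, rfl⟩
        by_contra hzz
        rw [Set.mem_insert_iff, not_or] at hzz
        refine hzz.1 (hcon z ?_ ?_)
        · rw [← hDD]; exact DC_inv hz
        · intro s hs hsz
          exact hzz.2 ⟨s, ⟨hs, DC_coset hz hsz.symm⟩, hsz⟩
      · exact Set.insert_subset hxO (hsub x)
    rw [this, Set.ncard_insert_of_notMem hxI, himg] at hev
    rw [Nat.even_add_one] at hev
    exact hev hev2
  · have hlt : ((fun g : G => (g : G ⧸ H)) '' (T ∩ DC H x)).ncard < (OC H x).ncard :=
      Set.ncard_lt_ncard ⟨hsub x, fun h => hxI (h hxO)⟩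
    have hlt2 : ((fun g : G => (g : G ⧸ H)) '' (T ∩ DC H x⁻¹)).ncard < (OC H x⁻¹).ncard := by
      rw [card_OC_inv, himg, hinv, ← Set.image_inv_eq_inv,
        Set.ncard_image_of_injective _ inv_injective, ← himg]
      exact hlt
    obtain ⟨_, ⟨z, hz, rfl⟩, hzn⟩ := Set.exists_mem_notMem_of_ncard_lt_ncard hlt2
    refine ⟨z, by simpa using DC_inv hz, ?_, ?_⟩
    · intro s hs hsz
      exact hzn ⟨s, ⟨hs, DC_coset hz hsz.symm⟩, hsz⟩
    · intro h
      exact hxx (DC_symm (DC_coset hz h))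

theorem pc_of_ncond {G : Type*} [Group G] [Finite G] (H : Subgroup G)
    (h2 : ∀ x : G, Even (OC H x).ncard ∨ (OC H x).ncard = 1) (hN : NCond H) :
    IsPerfectCode H := by
  obtain ⟨T, hT, hmax⟩ := (Set.toFinite {T : Set G | Good H T}).exists_maximal ⟨{1}, good_one⟩
  have hT : Good H T := hT
  refine ⟨T, hT.one, hT.inv, ?_⟩
  suffices hs : ∀ x : G, ∃ s ∈ T, (s : G ⧸ H) = x by
    intro g
    obtain ⟨s, hs, hsg⟩ := hs g
    refine ⟨s, ⟨hs, QuotientGroup.eq.1 hsg.symm⟩, ?_⟩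
    rintro t ⟨ht, htg⟩
    exact hT.inj ht hs ((QuotientGroup.eq.2 htg).symm.trans hsg.symm)
  intro x
  by_contra hcon
  push Not at hcon
  have key : ∃ t : G, (t : G ⧸ H) = x ∧ Good H (T ∪ {t, t⁻¹}) := by
    by_cases hc : x⁻¹ ∈ DC H x ∧ (OC H x).ncard = 1
    · obtain ⟨hxx, h1⟩ := hc
      have hall : ∀ y ∈ DC H x, (x : G ⧸ H) = y := by
        intro y hy
        exact ((Set.ncard_le_one_iff (Set.toFinite _)).1 h1.le) (mem_OC.2 (mem_DC_self x)) (mem_OC.2 hy)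
      obtain ⟨h, hh, hsq⟩ := hN x
        (fun h hh => by
          have := QuotientGroup.eq.1 (hall (h * x) ⟨h, hh, 1, H.one_mem, by simp⟩)
          simpa [mul_assoc] using this)
        (by
          have := H.inv_mem (QuotientGroup.eq.1 (hall _ hxx))
          simpa using this)
      have hm : ((x * h : G) : G ⧸ H) = x := by
        rw [eq_comm, QuotientGroup.eq]; simpa using hh
      have hi : (x * h)⁻¹ = x * h := inv_eq_of_mul_eq_one_left hsq
      refine ⟨x * h, hm, hT.extend ?_ ?_ (fun _ => hi.symm) ?_⟩
      · rw [hm]; exact hcon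
      · rw [hi, hm]; exact hcon
      · intro _
        rw [← h1, OC, OC, DC_eq (DC_coset (mem_DC_self x) hm.symm)]
    · obtain ⟨z, hz, hzT, hzx⟩ := good_count hT h2 hcon hc
      obtain ⟨t, ht, ht'⟩ := meet (mem_DC_self x) hz
      have hne : (t : G ⧸ H) ≠ (t⁻¹ : G) := by rw [ht, ht']; exact hzx.symm
      refine ⟨t, ht, hT.extend ?_ ?_ (fun h => absurd h hne) ?_⟩
      · rw [ht]; exact hcon
      · rw [ht']; exact hzT
      · intro h
        rw [inv_eq_of_mul_eq_one_left h] at hne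
        exact absurd rfl hne
  obtain ⟨t, ht, hg⟩ := key
  exact hcon t (hmax hg Set.subset_union_left (Or.inr (Or.inl rfl))) ht

theorem even_or_one {G : Type*} [Group G] [Finite G] (H Q : Subgroup G) (hQ : IsPGroup 2 Q)
    (hQH : Q ≤ H) (hH : ∀ h ∈ H, ∃ q ∈ Q, ∀ x : G, (q * x)⁻¹ * (h * x) ∈ H) (x : G) :
    Even (OC H x).ncard ∨ (OC H x).ncard = 1 := by
  have hO : OC H x = MulAction.orbit Q (x : G ⧸ H) := by
    ext c
    constructor
    · rintro ⟨_, ⟨a, ha, b, hb, rfl⟩, rfl⟩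
      obtain ⟨q, hq, hqx⟩ := hH a ha
      refine ⟨⟨q, hq⟩, ?_⟩
      change ((q * x : G) : G ⧸ H) = ((a * x * b : G) : G ⧸ H)
      rw [QuotientGroup.eq, ← mul_assoc]
      exact H.mul_mem (hqx x) hb
    · rintro ⟨q, rfl⟩
      exact ⟨q * x, ⟨q, hQH q.2, 1, H.one_mem, by simp⟩, rfl⟩
  have : Fact (Nat.Prime 2) := ⟨Nat.prime_two⟩
  obtain ⟨n, hn⟩ := hQ.card_orbit (x : G ⧸ H)
  rw [hO, ← Nat.card_coe_set_eq, hn]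
  rcases n with _ | n
  · right; simp
  · left; exact (Nat.even_pow.2 ⟨even_two, by simp⟩)

theorem odd_two_pow {G : Type*} [Group G] (K : Subgroup G) (hK : Odd (Nat.card K))
    {k : G} (hk : k ∈ K) {n : ℕ} (h : k ^ 2 ^ n = 1) : k = 1 := by
  have h1 : orderOf k ∣ Nat.card K := Subgroup.orderOf_dvd_natCard K hk
  have h2 : orderOf k ∣ 2 ^ n := orderOf_dvd_of_pow_eq_one h
  have hc : Nat.Coprime (Nat.card K) (2 ^ n) := (Nat.coprime_two_right.2 hK).pow_right n
  exact orderOf_eq_one_iff.1 (Nat.eq_one_of_dvd_coprimes hc h1 h2)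

theorem ncond_iff {G : Type*} [Group G] [Finite G]
    (Q K : Subgroup G) (hQ : IsPGroup 2 Q) (hK : Odd (Nat.card K)) [hKn : K.Normal] :
    NCond (Q ⊔ K) ↔ NCond Q := by
  have : Fact (Nat.Prime 2) := ⟨Nat.prime_two⟩
  have hmem : ∀ g : G, g ∈ Q ⊔ K ↔ ∃ q ∈ Q, ∃ k ∈ K, q * k = g := by
    intro g
    rw [← SetLike.mem_coe, Subgroup.mul_normal, Set.mem_mul]; rfl
  have hcj : ∀ (g : G), ∀ k ∈ K, g⁻¹ * k * g ∈ K := by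
    intro g k hk
    simpa using hKn.conj_mem k hk g⁻¹
  have hQK : ∀ g ∈ Q, g ∈ K → g = 1 := by
    intro g hg hgK
    obtain ⟨n, hn⟩ := hQ ⟨g, hg⟩
    exact odd_two_pow K hK hgK (n := n) (by simpa using congrArg Subtype.val hn)
  constructor
  · intro hJ x hx hxx
    obtain ⟨j, hj, hsq⟩ := hJ x
      (by
        intro h hh
        obtain ⟨q, hq, k, hk, rfl⟩ := (hmem h).1 hh
        exact (hmem _).2 ⟨_, hx q hq, _, hcj x k hk, by group⟩)
      ((le_sup_left : Q ≤ Q ⊔ K) hxx)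
    obtain ⟨q, hq, k, hk, rfl⟩ := (hmem j).1 hj
    refine ⟨q, hq, hQK _ ?_ ?_⟩
    · have := Q.mul_mem (Q.mul_mem hxx (hx q hq)) hq
      convert this using 1; group
    · have h1 := K.inv_mem (K.mul_mem (hcj (x * q) k hk) hk)
      have h2 : (x * q) * (x * q) * (((x * q)⁻¹ * k * (x * q)) * k) = 1 := by
        rw [← hsq]; group
      rw [eq_inv_of_mul_eq_one_left h2]
      exact h1
  · intro hN x hx hxx
    -- move `x` into the normaliser of `Q`
    have hidx : ¬ 2 ∣ (Q.subgroupOf (Q ⊔ K)).index := by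
      have hc1 := (Q.subgroupOf (Q ⊔ K)).card_mul_index
      have hc2 := (K.subgroupOf (Q ⊔ K)).card_mul_index
      rw [Nat.card_congr (Subgroup.subgroupOfEquivOfLe (le_sup_left : Q ≤ Q ⊔ K)).toEquiv] at hc1
      rw [Nat.card_congr (Subgroup.subgroupOfEquivOfLe (le_sup_right : K ≤ Q ⊔ K)).toEquiv] at hc2
      have hr : (K.subgroupOf (Q ⊔ K)).index = K.relIndex Q := Subgroup.relIndex_sup_right Q K
      obtain ⟨c, hc⟩ := Subgroup.relIndex_dvd_card K Q
      have hd : (Q.subgroupOf (Q ⊔ K)).index ∣ Nat.card K := by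
        refine ⟨c, ?_⟩
        rw [hr, ← hc1] at hc2
        have hpos : 0 < K.relIndex Q := Nat.pos_of_dvd_of_pos ⟨c, hc⟩ Nat.card_pos
        apply Nat.eq_of_mul_eq_mul_right hpos
        rw [hc2, hc]; ring
      intro h
      exact (Nat.not_even_iff_odd.2 hK) (even_iff_two_dvd.2 (h.trans hd))
    have hQJ : IsPGroup 2 (Q.subgroupOf (Q ⊔ K)) :=
      hQ.comap_of_injective (Q ⊔ K).subtype Subtype.val_injective
    let P : Sylow 2 ↥(Q ⊔ K) := hQJ.toSylow hidx
    have hQ' : IsPGroup 2 ((Q.map (MulAut.conj x⁻¹).toMonoidHom).subgroupOf (Q ⊔ K)) :=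
      (hQ.map _).comap_of_injective (Q ⊔ K).subtype Subtype.val_injective
    obtain ⟨P', hP'⟩ := hQ'.exists_le_sylow
    obtain ⟨j, hj⟩ := MulAction.exists_smul_eq ↥(Q ⊔ K) P P'
    have hy : ∀ h ∈ Q, (x * j)⁻¹ * h * (x * j) ∈ Q := by
      intro h hh
      have hmJ : x⁻¹ * h * x ∈ Q ⊔ K := hx h ((le_sup_left : Q ≤ Q ⊔ K) hh)
      have h1 : (⟨x⁻¹ * h * x, hmJ⟩ : ↥(Q ⊔ K)) ∈ P' := by
        apply hP'
        rw [Subgroup.mem_subgroupOf]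
        exact ⟨h, hh, by simp⟩
      rw [← hj] at h1
      have h2 := (Subgroup.mem_pointwise_smul_iff_inv_smul_mem (a := MulAut.conj j)).1 h1
      have h3 : (j : G)⁻¹ * (x⁻¹ * h * x) * j ∈ Q := by
        have h2 := Subgroup.mem_subgroupOf.1 h2
        simpa [← map_inv] using h2
      convert h3 using 1; group
    have hyy : (x * j) * (x * j) ∈ Q ⊔ K := by
      have := mul_mem (mul_mem hxx (hx j j.2)) j.2
      convert this using 1; group
    generalize hydef : x * (j : G) = y at hy hyy
    -- pass to the 2-part
    obtain ⟨a, m, hm, hord⟩ := Nat.exists_eq_two_pow_mul_odd (orderOf_pos y).ne'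
    have hyn : ∀ n : ℕ, ∀ h ∈ Q, (y ^ n)⁻¹ * h * y ^ n ∈ Q := by
      intro n
      induction n with
      | zero => intro h hh; simpa using hh
      | succ n ih =>
        intro h hh
        have := hy _ (ih h hh)
        convert this using 1; rw [pow_succ]; group
    have hz2 : (y ^ m) ^ 2 ^ a = 1 := by
      rw [← pow_mul, mul_comm, ← hord, pow_orderOf_eq_one]
    have hyz : y⁻¹ * y ^ m ∈ Q ⊔ K := by
      obtain ⟨r, rfl⟩ := hm
      have := pow_mem hyy r
      convert this using 1
      rw [pow_succ', inv_mul_cancel_left, pow_mul, pow_two]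
    have hzz : y ^ m * y ^ m ∈ Q ⊔ K := by
      have := pow_mem hyy m
      convert this using 1
      rw [← pow_two, ← pow_two, ← pow_mul, ← pow_mul, mul_comm]
    have hzn := hyn m
    generalize y ^ m = z at *
    have hzQ : z * z ∈ Q := by
      obtain ⟨q, hq, k, hk, hqk⟩ := (hmem _).1 hzz
      have hkc : ∀ p ∈ Q, p * k = k * p := by
        intro p hp
        have h1 : k⁻¹ * p * k ∈ Q := by
          have := hzn _ (hzn _ (Q.mul_mem (Q.mul_mem hq hp) (Q.inv_mem hq)))
          have e : k = q⁻¹ * (z * z) := by rw [← hqk]; group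
          convert this using 1
          rw [e]; group
        have h2 : p⁻¹ * (k⁻¹ * p * k) = 1 := by
          apply hQK _ (Q.mul_mem (Q.inv_mem hp) h1)
          have := K.mul_mem (hcj p _ (K.inv_mem hk)) hk
          convert this using 1; group
        have h3 : k⁻¹ * p * k = p := (inv_mul_eq_one.1 h2).symm
        calc p * k = k * (k⁻¹ * p * k) := by group
          _ = k * p := by rw [h3]
      have hpow : (q * k) ^ 2 ^ a = 1 := by
        rw [hqk, ← pow_two, ← pow_mul, mul_comm, pow_mul, hz2, one_pow]
      rw [(show Commute q k from hkc q hq).mul_pow] at hpow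
      have hk1 : k ^ 2 ^ a = 1 := by
        apply hQK _ _ (K.pow_mem hk _)
        rw [eq_inv_of_mul_eq_one_right hpow]
        exact Q.inv_mem (Q.pow_mem hq _)
      have := odd_two_pow K hK hk hk1
      rw [← hqk, this, mul_one]; exact hq
    obtain ⟨q, hq, hsq⟩ := hN z hzn hzQ
    refine ⟨j * (y⁻¹ * z) * q,
      mul_mem (mul_mem j.2 hyz) ((le_sup_left : Q ≤ Q ⊔ K) hq), ?_⟩
    have : x * (j * (y⁻¹ * z) * q) = z * q := by rw [← hydef]; group
    rw [this, hsq]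

theorem perfect_code_QK_normal {G : Type*} [Group G] [Finite G]
    (Q K : Subgroup G) (hQ : IsPGroup 2 Q) (hK : Odd (Nat.card K)) [K.Normal] :
    ∃ J : Subgroup G, (J : Set G) = (Q : Set G) * (K : Set G) ∧
      (IsPerfectCode J ↔ IsPerfectCode Q) := by
  refine ⟨Q ⊔ K, Subgroup.mul_normal Q K, ?_⟩
  have e1 : IsPerfectCode (Q ⊔ K) ↔ NCond (Q ⊔ K) := by
    refine ⟨ncond_of_pc _, pc_of_ncond _ (even_or_one _ Q hQ le_sup_left ?_)⟩
    intro h hh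
    rw [← SetLike.mem_coe, Subgroup.mul_normal, Set.mem_mul] at hh
    obtain ⟨q, hq, k, hk, rfl⟩ := hh
    refine ⟨q, hq, fun x => (le_sup_right : K ≤ Q ⊔ K) ?_⟩
    have : x⁻¹ * k * x⁻¹⁻¹ ∈ K := Subgroup.Normal.conj_mem inferInstance k hk x⁻¹
    convert this using 1; group
  have e2 : IsPerfectCode Q ↔ NCond Q := by
    refine ⟨ncond_of_pc _, pc_of_ncond _ (even_or_one _ Q hQ le_rfl ?_)⟩
    intro h hh
    exact ⟨h, hh, fun x => by simp⟩
  rw [e1, e2, ncond_iff Q K hQ hK]
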